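/- The map ψ : G_w × ℂ^× → (ℂ^×)^n defined by ψ(g,λ) = g·i_d(λ) is a group homomorphism whose image is exactly Γ_w, and whose kernel is the cyclic subgroup of order d generated by the element (J, exp(−2πi/d)). Equivalently, there is a short exact sequence of groups 1 → ℤ/d → G_w × ℂ^× → Γ_w → 1, in which 1 ∈ ℤ/d maps to (J, exp(−2πi/d)). -/

import Mathlib

/-- The action of a diagonal element `lam ∈ (ℂˣ)ⁿ` on a polynomial: substitute `lam j • X j`
for the variable `X j`. -/
noncomputable def scaleAct {n : ℕ} (lam : Fin n → ℂˣ) (w : MvPolynomial (Fin n) ℂ) :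
    MvPolynomial (Fin n) ℂ :=
  MvPolynomial.aeval (fun j => (lam j : ℂ) • MvPolynomial.X j) w

/-- The group `G_w` of diagonal symmetries of `w`, as a set. -/
def GwSet {n : ℕ} (w : MvPolynomial (Fin n) ℂ) : Set (Fin n → ℂˣ) :=
  {lam | scaleAct lam w = w}

/-- The group `Γ_w` of diagonal transformations under which `w` is semi-invariant, as a set. -/
def GammaWSet {n : ℕ} (w : MvPolynomial (Fin n) ℂ) : Set (Fin n → ℂˣ) :=
  {lam | ∃ c : ℂˣ, scaleAct lam w = (c : ℂ) • w}

/-- The one-parameter subgroup `i_d(λ) = (λ^{d_1}, …, λ^{d_n})`. -/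
def idMapD {n : ℕ} (dw : Fin n → ℕ) (lam : ℂˣ) : Fin n → ℂˣ :=
  fun j => lam ^ dw j

/-- The exponential grading element `J = i_d(exp(2πi/d))`. -/
noncomputable def Jelt {n : ℕ} (dw : Fin n → ℕ) (d : ℕ) : Fin n → ℂˣ :=
  idMapD dw (Units.mk0 (Complex.exp (2 * Real.pi * Complex.I / d)) (Complex.exp_ne_zero _))

/-- The unit `exp(-2πi/d)` of `ℂ`. -/
noncomputable def zetaU (d : ℕ) : ℂˣ :=
  Units.mk0 (Complex.exp (-(2 * Real.pi * Complex.I) / d)) (Complex.exp_ne_zero _)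

theorem coeff_scaleAct {n : ℕ} (lam : Fin n → ℂˣ) (w : MvPolynomial (Fin n) ℂ)
    (m : Fin n →₀ ℕ) :
    (scaleAct lam w).coeff m = ((∏ j, lam j ^ m j : ℂˣ) : ℂ) * w.coeff m := by
  have key (u : Fin n →₀ ℕ) (a : ℂ) : scaleAct lam (MvPolynomial.monomial u a) =
      MvPolynomial.monomial u (((∏ j, lam j ^ u j : ℂˣ) : ℂ) * a) := by
    rw [scaleAct, MvPolynomial.aeval_monomial, Finsupp.prod_fintype _ _ (fun _ => pow_zero _),
      MvPolynomial.monomial_eq, Finsupp.prod_fintype _ _ (fun _ => pow_zero _)]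
    simp only [MvPolynomial.smul_eq_C_mul, mul_pow, Finset.prod_mul_distrib,
      MvPolynomial.algebraMap_eq, Units.coe_prod, Units.val_pow_eq_pow_val, map_mul, map_prod,
      map_pow]
    ring
  induction w using MvPolynomial.induction_on' with
  | monomial u a =>
    rw [key, MvPolynomial.coeff_monomial, MvPolynomial.coeff_monomial]
    split_ifs with h
    · rw [h]
    · rw [mul_zero]
  | add p q hp hq =>
    have hadd : scaleAct lam (p + q) = scaleAct lam p + scaleAct lam q := map_add _ _ _
    rw [hadd, MvPolynomial.coeff_add, hp, hq, MvPolynomial.coeff_add, mul_add]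

theorem scaleAct_eq_smul_iff {n : ℕ} (lam : Fin n → ℂˣ) (w : MvPolynomial (Fin n) ℂ) (c : ℂˣ) :
    scaleAct lam w = (c : ℂ) • w ↔ ∀ m ∈ w.support, ∏ j, lam j ^ m j = c := by
  rw [MvPolynomial.ext_iff]
  refine forall_congr' fun m => ?_
  rw [coeff_scaleAct, MvPolynomial.coeff_smul, smul_eq_mul, MvPolynomial.mem_support_iff]
  by_cases h : w.coeff m = 0
  · simp [h]
  · simp [h, -Units.coe_prod, Units.ext_iff]

theorem mem_GwSet_iff {n : ℕ} (lam : Fin n → ℂˣ) (w : MvPolynomial (Fin n) ℂ) :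
    lam ∈ GwSet w ↔ ∀ m ∈ w.support, ∏ j, lam j ^ m j = 1 := by
  rw [← scaleAct_eq_smul_iff, Units.val_one, one_smul]
  rfl

theorem mem_GammaWSet_iff {n : ℕ} (lam : Fin n → ℂˣ) (w : MvPolynomial (Fin n) ℂ) :
    lam ∈ GammaWSet w ↔ ∃ c : ℂˣ, ∀ m ∈ w.support, ∏ j, lam j ^ m j = c :=
  exists_congr fun c => scaleAct_eq_smul_iff lam w c

/-- The one-parameter subgroup `idMapD` as a group homomorphism. -/
def idMapDHom {n : ℕ} (dw : Fin n → ℕ) : ℂˣ →* (Fin n → ℂˣ) where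
  toFun := idMapD dw
  map_one' := funext fun _ => one_pow _
  map_mul' _ _ := funext fun _ => mul_pow _ _ _

theorem prod_idMapD_pow {n : ℕ} (dw : Fin n → ℕ) (μ : ℂˣ) (m : Fin n →₀ ℕ) :
    ∏ j, idMapD dw μ j ^ m j = μ ^ ∑ j, m j * dw j := by
  simp only [idMapD, ← pow_mul, Finset.prod_pow_eq_pow_sum, mul_comm]

theorem zetaU_eq_inv (d : ℕ) :
    zetaU d = (Units.mk0 (Complex.exp (2 * Real.pi * Complex.I / d)) (Complex.exp_ne_zero _))⁻¹ := by
  ext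
  simp [zetaU, neg_div, Complex.exp_neg]

theorem isPrimitiveRoot_zetaU {d : ℕ} (hd : d ≠ 0) : IsPrimitiveRoot (zetaU d) d := by
  rw [zetaU_eq_inv]
  exact (IsPrimitiveRoot.coe_units_iff.mp (Complex.isPrimitiveRoot_exp d hd)).inv

theorem Jelt_eq {n : ℕ} (dw : Fin n → ℕ) (d : ℕ) : Jelt dw d = idMapDHom dw (zetaU d)⁻¹ := by
  rw [zetaU_eq_inv, inv_inv]
  rfl

/-- The antidiagonal embedding `μ ↦ (i_d(μ⁻¹), μ)`. -/
def antidiagHom {n : ℕ} (dw : Fin n → ℕ) : ℂˣ →* (Fin n → ℂˣ) × ℂˣ :=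
  (idMapDHom dw)⁻¹.prod (MonoidHom.id ℂˣ)

theorem antidiagHom_zetaU {n : ℕ} (dw : Fin n → ℕ) (d : ℕ) :
    antidiagHom dw (zetaU d) = (Jelt dw d, zetaU d) := by
  rw [Jelt_eq, map_inv]
  rfl

theorem antidiagHom_injective {n : ℕ} (dw : Fin n → ℕ) : Function.Injective (antidiagHom dw) :=
  fun _ _ h => congrArg Prod.snd h

/-- `ψ(g,λ) = g·i_d(λ)` is a group homomorphism `G_w × ℂˣ → (ℂˣ)ⁿ` with image
`Γ_w` and kernel the cyclic subgroup of order `d` generated by `(J, exp(-2πi/d))`; i.e. there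
is a short exact sequence `1 → ℤ/d → G_w × ℂˣ → Γ_w → 1`. -/
theorem stmt1 (n : ℕ) (hn : 1 ≤ n) (dw : Fin n → ℕ) (hdw : ∀ j, 0 < dw j)
    (hgcd : Finset.univ.gcd dw = 1) (d : ℕ) (hd : 1 ≤ d)
    (w : MvPolynomial (Fin n) ℂ) (hw : w ≠ 0)
    (hquasi : ∀ m ∈ w.support, ∑ j, m j * dw j = d) :
    (∀ p q : (Fin n → ℂˣ) × ℂˣ,
      (p * q).1 * idMapD dw (p * q).2 = (p.1 * idMapD dw p.2) * (q.1 * idMapD dw q.2)) ∧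
    (fun p : (Fin n → ℂˣ) × ℂˣ => p.1 * idMapD dw p.2) '' {p | p.1 ∈ GwSet w}
      = GammaWSet w ∧
    {p : (Fin n → ℂˣ) × ℂˣ | p.1 ∈ GwSet w ∧ p.1 * idMapD dw p.2 = 1}
      = (Subgroup.zpowers ((Jelt dw d, zetaU d) : (Fin n → ℂˣ) × ℂˣ) :
          Set ((Fin n → ℂˣ) × ℂˣ)) ∧
    orderOf ((Jelt dw d, zetaU d) : (Fin n → ℂˣ) × ℂˣ) = d := by
  have hpow (μ : ℂˣ) (m) (hm : m ∈ w.support) : ∏ j, idMapD dw μ j ^ m j = μ ^ d := by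
    rw [prod_idMapD_pow, hquasi m hm]
  have hd0 : d ≠ 0 := Nat.one_le_iff_ne_zero.mp hd
  have : NeZero d := ⟨hd0⟩
  refine ⟨fun p q => ?_, ?_, ?_, ?_⟩
  · have h : idMapD dw (p * q).2 = idMapD dw p.2 * idMapD dw q.2 :=
      map_mul (idMapDHom dw) p.2 q.2
    rw [h, Prod.fst_mul, mul_mul_mul_comm]
  · ext lam
    rw [mem_GammaWSet_iff]
    constructor
    · rintro ⟨p, hp, rfl⟩
      refine ⟨p.2 ^ d, fun m hm => ?_⟩
      simp only [Pi.mul_apply, mul_pow, Finset.prod_mul_distrib]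
      rw [(mem_GwSet_iff _ _).mp hp m hm, hpow _ m hm, one_mul]
    · rintro ⟨c, hc⟩
      obtain ⟨z, hz⟩ := IsAlgClosed.exists_pow_nat_eq (c : ℂ) hd
      have hz0 : z ≠ 0 := by
        rintro rfl
        exact c.ne_zero (by rw [← hz, zero_pow hd0])
      have hμ : Units.mk0 z hz0 ^ d = c := Units.ext hz
      refine ⟨(lam / idMapD dw (Units.mk0 z hz0), Units.mk0 z hz0), ?_, div_mul_cancel _ _⟩
      refine (mem_GwSet_iff _ _).mpr fun m hm => ?_
      simp only [Pi.div_apply, div_pow, Finset.prod_div_distrib]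
      rw [hc m hm, hpow _ m hm, hμ, div_self']
  · obtain ⟨m₀, hm₀⟩ := MvPolynomial.support_nonempty.mpr hw
    have hinv (μ : ℂˣ) : (idMapD dw μ)⁻¹ ∈ GwSet w ↔ μ ^ d = 1 := by
      have hprod (m) (hm : m ∈ w.support) : ∏ j, (idMapD dw μ)⁻¹ j ^ m j = (μ ^ d)⁻¹ := by
        simp only [Pi.inv_apply, inv_pow, Finset.prod_inv_distrib, hpow μ m hm]
      rw [mem_GwSet_iff]
      refine ⟨fun h => ?_, fun h m hm => ?_⟩
      · rw [← inv_eq_one, ← hprod m₀ hm₀, h m₀ hm₀]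
      · rw [hprod m hm, h, inv_one]
    rw [← antidiagHom_zetaU, ← MonoidHom.map_zpowers, (isPrimitiveRoot_zetaU hd0).zpowers_eq]
    ext ⟨g, μ⟩
    constructor
    · rintro ⟨hg, h⟩
      obtain rfl : g = (idMapD dw μ)⁻¹ := eq_inv_of_mul_eq_one_left h
      exact ⟨μ, (mem_rootsOfUnity _ _).mpr ((hinv μ).mp hg), rfl⟩
    · rintro ⟨ν, hν, h⟩
      obtain ⟨rfl, rfl⟩ := Prod.mk.inj h
      exact ⟨(hinv ν).mpr ((mem_rootsOfUnity _ _).mp hν), inv_mul_cancel _⟩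
  · rw [← antidiagHom_zetaU, orderOf_injective _ (antidiagHom_injective dw)]
    exact (isPrimitiveRoot_zetaU hd0).eq_orderOf.symm
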